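/- arXiv:0906.4617 — 3 statements merged into one kernel-verified Lean document; each statement's English description precedes it below -/
import Mathlib

section
/- Let K be a field and V a 2-dimensional K-vector space with basis x₁, x₂. Let c : V ⊗ V → V ⊗ V and β : V ⊗ V → V be K-linear maps with β(x₁⊗x₁) = 0, β(x₂⊗x₁) = r·x₁, β(x₁⊗x₂) = s·x₁, β(x₂⊗x₂) = t·x₁, and c(x₁⊗x₁) = a·x₁⊗x₁, c(x₂⊗x₁) = u·x₁⊗x₁ + p·x₁⊗x₂, c(x₁⊗x₂) = v·x₁⊗x₁ + q·x₂⊗x₁, c(x₂⊗x₂) = w₁·x₁⊗x₁ + w₂·x₂⊗x₁ + w₃·x₁⊗x₂ + d·x₂⊗x₂, for scalars a,u,v,p,q,w₁,w₂,w₃,d,r,s,t ∈ K. Assume β ∘ c = −β and c ∘ (β ⊗ id_V) = (id_V ⊗ β) ∘ c₁ ∘ c₂ (where c₁ := c ⊗ id_V and c₂ := id_V ⊗ c on V⊗V⊗V). Then −r = s·p and −s = q·r; moreover, if a ≠ 0, then r + s = 0. -/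
open TensorProduct Polynomial

noncomputable section

variable (K V : Type*) [Field K] [AddCommGroup V] [Module K V]

/-- `c₁ := c ⊗ id` on `V ⊗ V ⊗ V` (transported along the associator). -/
def cOne (c : (V ⊗[K] V) →ₗ[K] (V ⊗[K] V)) :
    (V ⊗[K] (V ⊗[K] V)) →ₗ[K] (V ⊗[K] (V ⊗[K] V)) :=
  (TensorProduct.assoc K V V V).toLinearMap ∘ₗ LinearMap.rTensor V c ∘ₗ
    (TensorProduct.assoc K V V V).symm.toLinearMap

/-- `c₂ := id ⊗ c` on `V ⊗ V ⊗ V`. -/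
def cTwo (c : (V ⊗[K] V) →ₗ[K] (V ⊗[K] V)) :
    (V ⊗[K] (V ⊗[K] V)) →ₗ[K] (V ⊗[K] (V ⊗[K] V)) :=
  LinearMap.lTensor V c

/-- `β₁ := β ⊗ id : V ⊗ V ⊗ V → V ⊗ V`. -/
def betaOne (β : (V ⊗[K] V) →ₗ[K] V) :
    (V ⊗[K] (V ⊗[K] V)) →ₗ[K] (V ⊗[K] V) :=
  LinearMap.rTensor V β ∘ₗ (TensorProduct.assoc K V V V).symm.toLinearMap

/-- `β₂ := id ⊗ β : V ⊗ V ⊗ V → V ⊗ V`. -/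
def betaTwo (β : (V ⊗[K] V) →ₗ[K] V) :
    (V ⊗[K] (V ⊗[K] V)) →ₗ[K] (V ⊗[K] V) :=
  LinearMap.lTensor V β

/-- A lifted quadratic Lie algebra structure `(V, c, β)`:
the braiding `c` satisfies the quantum Yang–Baxter equation,
(B1) `c ∘ β₁ = β₂ ∘ c₁ ∘ c₂`, (B2) `c ∘ β₂ = β₁ ∘ c₂ ∘ c₁`,
(J) `β ∘ (β₁ − β₂)` vanishes on `Ē₂(V,c) = {z | c₁ z = −z = c₂ z}`, and
(A) `β ∘ c = −β`. -/
def IsLiftedQLie (c : (V ⊗[K] V) →ₗ[K] (V ⊗[K] V)) (β : (V ⊗[K] V) →ₗ[K] V) : Prop :=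
  (cOne K V c ∘ₗ cTwo K V c ∘ₗ cOne K V c = cTwo K V c ∘ₗ cOne K V c ∘ₗ cTwo K V c) ∧
  (c ∘ₗ betaOne K V β = betaTwo K V β ∘ₗ cOne K V c ∘ₗ cTwo K V c) ∧
  (c ∘ₗ betaTwo K V β = betaOne K V β ∘ₗ cTwo K V c ∘ₗ cOne K V c) ∧
  (∀ z : V ⊗[K] (V ⊗[K] V), cOne K V c z = -z → cTwo K V c z = -z →
    β (betaOne K V β z - betaTwo K V β z) = 0) ∧
  (β ∘ₗ c = -β)

/-- With `V` two-dimensional with basis `x₁, x₂`, and `c`, `β` given on basis tensors as in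
Lemma `lem: c1111 non zero` of the paper, if `β ∘ c = −β` and
`c ∘ β₁ = β₂ ∘ c₁ ∘ c₂`, then `−r = s·p` and `−s = q·r`; if moreover `a ≠ 0` then
`r + s = 0`. -/
theorem coefficients_relations
    (b : Module.Basis (Fin 2) K V)
    (c : (V ⊗[K] V) →ₗ[K] (V ⊗[K] V)) (β : (V ⊗[K] V) →ₗ[K] V)
    (a u v p q w1 w2 w3 d r s t : K)
    (hβ11 : β (b 0 ⊗ₜ[K] b 0) = 0)
    (hβ21 : β (b 1 ⊗ₜ[K] b 0) = r • b 0)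
    (hβ12 : β (b 0 ⊗ₜ[K] b 1) = s • b 0)
    (hβ22 : β (b 1 ⊗ₜ[K] b 1) = t • b 0)
    (hc11 : c (b 0 ⊗ₜ[K] b 0) = a • (b 0 ⊗ₜ[K] b 0))
    (hc21 : c (b 1 ⊗ₜ[K] b 0) = u • (b 0 ⊗ₜ[K] b 0) + p • (b 0 ⊗ₜ[K] b 1))
    (hc12 : c (b 0 ⊗ₜ[K] b 1) = v • (b 0 ⊗ₜ[K] b 0) + q • (b 1 ⊗ₜ[K] b 0))
    (hc22 : c (b 1 ⊗ₜ[K] b 1) =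
      w1 • (b 0 ⊗ₜ[K] b 0) + w2 • (b 1 ⊗ₜ[K] b 0) + w3 • (b 0 ⊗ₜ[K] b 1) +
        d • (b 1 ⊗ₜ[K] b 1))
    (hA : β ∘ₗ c = -β)
    (hB1 : c ∘ₗ betaOne K V β = betaTwo K V β ∘ₗ cOne K V c ∘ₗ cTwo K V c) :
    (-r = s * p ∧ -s = q * r) ∧ (a ≠ 0 → r + s = 0) := by
  have h21 := LinearMap.congr_fun hA (b 1 ⊗ₜ[K] b 0)
  have h12 := LinearMap.congr_fun hA (b 0 ⊗ₜ[K] b 1)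
  have hB := LinearMap.congr_fun hB1 (b 0 ⊗ₜ[K] (b 1 ⊗ₜ[K] b 0))
  simp only [LinearMap.comp_apply, LinearMap.neg_apply, hc21, hc12, map_add, map_smul, hβ11,
    hβ21, hβ12, smul_zero, zero_add] at h21 h12
  have e1 : -r = s * p := by
    have := congrArg (fun z => b.repr z 0) h21
    simp at this
    linear_combination -this
  have e2 : -s = q * r := by
    have := congrArg (fun z => b.repr z 0) h12
    simp at this
    linear_combination -this
  refine ⟨⟨e1, e2⟩, fun ha => ?_⟩
  simp [betaOne, betaTwo, cOne, cTwo, hc21, hc11, hβ12, hβ11, tmul_add, add_tmul, tmul_smul,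
    ← smul_tmul'] at hB
  have h3 := congrArg (fun z => (b.tensorProduct b).repr z (0, 0)) hB
  simp at h3
  have h4 : a * (r + s) = 0 := by linear_combination h3 - a * e1
  exact (mul_eq_zero.mp h4).resolve_left ha

end
end

section
/- Let K be a field with char K ≠ 2, V a 2-dimensional K-vector space with basis x₁, x₂, and γ ∈ K. Let c : V ⊗ V → V ⊗ V be the K-linear map with c(x₁⊗x₁) = x₁⊗x₁, c(x₂⊗x₁) = x₁⊗x₂, c(x₁⊗x₂) = x₂⊗x₁, c(x₂⊗x₂) = γ·x₁⊗x₁ − x₂⊗x₂, and let β : V ⊗ V → V be the K-linear map with β(x₂⊗x₂) = x₁ and β(x₁⊗x₁) = β(x₂⊗x₁) = β(x₁⊗x₂) = 0. Then (V, c, β) is a lifted QLie algebra; moreover E₂(V,c) = ker(c + Id_{V⊗V}) is the span of γ·x₁⊗x₁ − 2·x₂⊗x₂ and x₂⊗x₁ − x₁⊗x₂. -/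
open TensorProduct Polynomial

noncomputable section

variable (K V : Type*) [Field K] [AddCommGroup V] [Module K V]

/-- Linear maps on `V ⊗ V ⊗ V` agreeing on basis tensors are equal. -/
theorem ext_three {K V W : Type*} [Field K] [AddCommGroup V] [Module K V]
    [AddCommGroup W] [Module K W] (b : Module.Basis (Fin 2) K V)
    (f g : (V ⊗[K] (V ⊗[K] V)) →ₗ[K] W)
    (h : ∀ i j k, f (b i ⊗ₜ[K] (b j ⊗ₜ[K] b k)) = g (b i ⊗ₜ[K] (b j ⊗ₜ[K] b k))) : f = g := by
  refine (b.tensorProduct (b.tensorProduct b)).ext ?_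
  rintro ⟨i, j, k⟩
  simpa using h i j k

theorem ext_two {K V W : Type*} [Field K] [AddCommGroup V] [Module K V]
    [AddCommGroup W] [Module K W] (b : Module.Basis (Fin 2) K V)
    (f g : (V ⊗[K] V) →ₗ[K] W)
    (h : ∀ i j, f (b i ⊗ₜ[K] b j) = g (b i ⊗ₜ[K] b j)) : f = g := by
  refine (b.tensorProduct b).ext ?_
  rintro ⟨i, j⟩
  simpa using h i j

/-- The fourth canonical form of Table 1: `c(x₁⊗x₁) = x₁⊗x₁`, `c(x₂⊗x₁) = x₁⊗x₂`,
`c(x₁⊗x₂) = x₂⊗x₁`, `c(x₂⊗x₂) = γ·x₁⊗x₁ − x₂⊗x₂`, `β(x₂⊗x₂) = x₁` and `β = 0` on the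
other basis tensors, give a lifted QLie algebra with
`E₂(V,c) = span{γ·x₁⊗x₁ − 2·x₂⊗x₂, x₂⊗x₁ − x₁⊗x₂}`. -/
theorem case4_liftedQLie
    (hchar : ringChar K ≠ 2)
    (b : Module.Basis (Fin 2) K V) (γ : K)
    (c : (V ⊗[K] V) →ₗ[K] (V ⊗[K] V)) (β : (V ⊗[K] V) →ₗ[K] V)
    (hc11 : c (b 0 ⊗ₜ[K] b 0) = b 0 ⊗ₜ[K] b 0)
    (hc21 : c (b 1 ⊗ₜ[K] b 0) = b 0 ⊗ₜ[K] b 1)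
    (hc12 : c (b 0 ⊗ₜ[K] b 1) = b 1 ⊗ₜ[K] b 0)
    (hc22 : c (b 1 ⊗ₜ[K] b 1) = γ • (b 0 ⊗ₜ[K] b 0) - b 1 ⊗ₜ[K] b 1)
    (hβ11 : β (b 0 ⊗ₜ[K] b 0) = 0)
    (hβ21 : β (b 1 ⊗ₜ[K] b 0) = 0)
    (hβ12 : β (b 0 ⊗ₜ[K] b 1) = 0)
    (hβ22 : β (b 1 ⊗ₜ[K] b 1) = b 0) :
    IsLiftedQLie K V c β ∧
    LinearMap.ker (c + (LinearMap.id : (V ⊗[K] V) →ₗ[K] (V ⊗[K] V))) =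
      Submodule.span K
        {γ • (b 0 ⊗ₜ[K] b 0) - (2 : K) • (b 1 ⊗ₜ[K] b 1),
          b 1 ⊗ₜ[K] b 0 - b 0 ⊗ₜ[K] b 1} := by
  have h2 : (2 : K) ≠ 0 := Ring.two_ne_zero hchar
  refine ⟨⟨?_, ?_, ?_, ?_, ?_⟩, ?_⟩
  · refine ext_three b _ _ fun i j k => ?_
    fin_cases i <;> fin_cases j <;> fin_cases k <;>
      simp [cOne, cTwo, hc11, hc12, hc21, hc22, tmul_sub, sub_tmul, tmul_smul, ← smul_tmul']
    all_goals try abel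
  · refine ext_three b _ _ fun i j k => ?_
    fin_cases i <;> fin_cases j <;> fin_cases k <;>
      simp [cOne, cTwo, betaOne, betaTwo, hc11, hc12, hc21, hc22, hβ11, hβ12, hβ21, hβ22,
        tmul_sub, sub_tmul, tmul_smul, ← smul_tmul']
  · refine ext_three b _ _ fun i j k => ?_
    fin_cases i <;> fin_cases j <;> fin_cases k <;>
      simp [cOne, cTwo, betaOne, betaTwo, hc11, hc12, hc21, hc22, hβ11, hβ12, hβ21, hβ22,
        tmul_sub, sub_tmul, tmul_smul, ← smul_tmul']
  · intro z _ _
    have h : β ∘ₗ (betaOne K V β - betaTwo K V β) = 0 := by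
      refine ext_three b _ _ fun i j k => ?_
      fin_cases i <;> fin_cases j <;> fin_cases k <;>
        simp [betaOne, betaTwo, hβ11, hβ12, hβ21, hβ22]
    simpa using LinearMap.congr_fun h z
  · refine ext_two b _ _ fun i j => ?_
    fin_cases i <;> fin_cases j <;> simp [hc11, hc12, hc21, hc22, hβ11, hβ12, hβ21, hβ22]
  · apply le_antisymm
    · intro z hz
      obtain ⟨p, q, r, s, rfl⟩ : ∃ p q r s : K, z = p • (b 0 ⊗ₜ[K] b 0) + q • (b 0 ⊗ₜ[K] b 1)
          + r • (b 1 ⊗ₜ[K] b 0) + s • (b 1 ⊗ₜ[K] b 1) := by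
        have := (b.tensorProduct b).sum_repr z
        rw [Fintype.sum_prod_type] at this
        simp only [Fin.sum_univ_two, Module.Basis.tensorProduct_apply] at this
        exact ⟨_, _, _, _, by rw [← add_assoc] at this; exact this.symm⟩
      have e : (c + LinearMap.id : (V ⊗[K] V) →ₗ[K] (V ⊗[K] V)) (p • (b 0 ⊗ₜ[K] b 0)
          + q • (b 0 ⊗ₜ[K] b 1) + r • (b 1 ⊗ₜ[K] b 0) + s • (b 1 ⊗ₜ[K] b 1)) =
          (2 * p + s * γ) • (b 0 ⊗ₜ[K] b 0) + (q + r) • (b 0 ⊗ₜ[K] b 1)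
          + (q + r) • (b 1 ⊗ₜ[K] b 0) := by
        simp only [LinearMap.add_apply, LinearMap.id_apply, map_add, map_smul,
          hc11, hc12, hc21, hc22]
        module
      rw [LinearMap.mem_ker, e] at hz
      have k1 := congrArg (fun w => (b.tensorProduct b).repr w (0, 0)) hz
      have k2 := congrArg (fun w => (b.tensorProduct b).repr w (0, 1)) hz
      simp [Module.Basis.tensorProduct_repr_tmul_apply] at k1 k2
      rw [Submodule.mem_span_pair]
      refine ⟨-s / 2, r, ?_⟩
      have hp : p = -s / 2 * γ := by field_simp; linear_combination k1
      have hq : q = -r := by linear_combination k2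
      have hs : s = -(-s / 2 * 2) := by field_simp
      rw [hp, hq]
      conv_rhs => rw [hs]
      generalize hu : -s / 2 = u
      have hs2 : s = -(u * 2) := by rw [← hu]; exact hs
      subst hs2
      have : -(-(u * 2)) / 2 = u := by field_simp
      simp only [this]
      module
    · rw [Submodule.span_le]
      rintro z (rfl | rfl)
      · simp only [SetLike.mem_coe, LinearMap.mem_ker, LinearMap.add_apply, LinearMap.id_apply,
          map_sub, map_smul, hc11, hc22]
        module
      · simp [hc12, hc21]

end
end

section
/- Let K be a field with char K ≠ 2 and let (V, c, β) be a lifted QLie algebra over K with dim_K V = 2 and β ≠ 0, such that the minimal polynomial of c (as an endomorphism of V ⊗ V) has the form f = (X+1)·h with h ∈ K[X], h(−1) ≠ 0, and such that dim_K Im β = 1. Then there exist a basis x₁, x₂ of V and γ ∈ K such that c and β are given on the basis tensors by exactly one of the following eight canonical forms, where in cases (1),(2),(3),(5),(7),(8) β is defined by β(x₂⊗x₁) = x₁, β(x₁⊗x₂) = −x₁, β(x₁⊗x₁) = β(x₂⊗x₂) = 0: (1) c is the flip c(x_i⊗x_j) = x_j⊗x_i; (2) c(x₁⊗x₁) = x₁⊗x₁,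 c(x₂⊗x₁) = x₁⊗x₁ + x₁⊗x₂, c(x₁⊗x₂) = −x₁⊗x₁ + x₂⊗x₁, c(x₂⊗x₂) = x₂⊗x₂; (3) c(x₁⊗x₁) = −x₁⊗x₁, c(x₂⊗x₁) = x₁⊗x₂, c(x₁⊗x₂) = x₂⊗x₁, c(x₂⊗x₂) = γ·x₁⊗x₁ + x₂⊗x₂, with γ ∈ {0,1} or γ having no square root in K; (4) c(x₁⊗x₁) = x₁⊗x₁, c(x₂⊗x₁) = x₁⊗x₂, c(x₁⊗x₂) = x₂⊗x₁, c(x₂⊗x₂) = γ·x₁⊗x₁ − x₂⊗x₂, with γ ∈ {0,1} or γ having no square root in K, and β(x₂⊗x₂) = x₁, β = 0 on the other three basis tensors; (5) c(x₁⊗x₁) = 0, c(x₂⊗x₁) = x₁⊗x₁ + x₁⊗x₂, c(x₁⊗x₂) = x₂⊗x₁, c(x₂⊗x₂) = x₂⊗x₂; (6) c(x₁⊗x₁) = 0, c(x₂⊗x₁) = γ⁻¹·x₁⊗x₂, c(x₁⊗x₂) = γ·x₂⊗x₁, c(x₂⊗x₂) = x₂⊗x₂, with γ ≠ 0, 1,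 and β(x₂⊗x₁) = x₁, β(x₁⊗x₂) = −γ·x₁, β(x₁⊗x₁) = β(x₂⊗x₂) = 0; (7) c(x₁⊗x₁) = γ·x₁⊗x₁, c(x₂⊗x₁) = x₁⊗x₂, c(x₁⊗x₂) = x₂⊗x₁, c(x₂⊗x₂) = x₂⊗x₂, with γ ≠ ±1; (8) c(x₁⊗x₁) = x₁⊗x₁, c(x₂⊗x₁) = x₁⊗x₂, c(x₁⊗x₂) = x₂⊗x₁, c(x₂⊗x₂) = γ·x₁⊗x₁ + x₂⊗x₂, with γ = 1 or γ having no square root in K. -/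
open TensorProduct Polynomial

noncomputable section

variable (K V : Type*) [Field K] [AddCommGroup V] [Module K V]

/-- The "standard" bracket of Table 1: `β(x₂⊗x₁) = x₁`, `β(x₁⊗x₂) = −x₁`,
`β(x₁⊗x₁) = β(x₂⊗x₂) = 0`. -/
def BetaStd (b : Module.Basis (Fin 2) K V) (β : (V ⊗[K] V) →ₗ[K] V) : Prop :=
  β (b 0 ⊗ₜ[K] b 0) = 0 ∧ β (b 1 ⊗ₜ[K] b 0) = b 0 ∧
  β (b 0 ⊗ₜ[K] b 1) = - b 0 ∧ β (b 1 ⊗ₜ[K] b 1) = 0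

theorem newBasis (b : Module.Basis (Fin 2) K V) (u v t : K) (hu : u ≠ 0) (hv : v ≠ 0) :
    ∃ b' : Module.Basis (Fin 2) K V, b' 0 = u • b 0 ∧ b' 1 = v • b 1 + t • b 0 := by
  have hli : LinearIndependent K ![u • b 0, v • b 1 + t • b 0] := by
    rw [LinearIndependent.pair_iff]
    intro x y h
    have h1 := congrArg (b.coord 1) h
    have h0 := congrArg (b.coord 0) h
    simp at h0 h1
    have hy : y = 0 := by tauto
    subst hy
    simp [hu] at h0
    exact ⟨h0, rfl⟩
  have hc : Fintype.card (Fin 2) = Module.finrank K V := (Module.finrank_eq_card_basis b).symm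
  have : Nonempty (Fin 2) := ⟨0⟩
  refine ⟨basisOfLinearIndependentOfCardEqFinrank hli hc, ?_, ?_⟩ <;> simp

/-- Two-fold coordinate. -/
def co2 (b : Module.Basis (Fin 2) K V) (i j : Fin 2) : (V ⊗[K] V) →ₗ[K] K :=
  LinearMap.mul' K K ∘ₗ TensorProduct.map (b.coord i) (b.coord j)

/-- Three-fold coordinate. -/
def co3 (b : Module.Basis (Fin 2) K V) (i j k : Fin 2) : (V ⊗[K] (V ⊗[K] V)) →ₗ[K] K :=
  LinearMap.mul' K K ∘ₗ TensorProduct.map (b.coord i) (co2 K V b j k)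

theorem co2_tmul (b : Module.Basis (Fin 2) K V) (i j : Fin 2) (x y : V) :
    co2 K V b i j (x ⊗ₜ y) = b.coord i x * b.coord j y := by simp [co2]

theorem co3_tmul (b : Module.Basis (Fin 2) K V) (i j k : Fin 2) (x y z : V) :
    co3 K V b i j k (x ⊗ₜ (y ⊗ₜ z)) = b.coord i x * (b.coord j y * b.coord k z) := by
  simp [co3, co2]

theorem expand2 (b : Module.Basis (Fin 2) K V) (z : V ⊗[K] V) :
    z = co2 K V b 0 0 z • (b 0 ⊗ₜ[K] b 0) + co2 K V b 0 1 z • (b 0 ⊗ₜ[K] b 1)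
      + co2 K V b 1 0 z • (b 1 ⊗ₜ[K] b 0) + co2 K V b 1 1 z • (b 1 ⊗ₜ[K] b 1) := by
  induction z with
  | zero => simp
  | add x y hx hy =>
    simp only [map_add, add_smul]
    nth_rewrite 1 [hx, hy]
    abel
  | tmul x y =>
    nth_rewrite 1 [← b.sum_repr x, ← b.sum_repr y]
    simp only [Fin.sum_univ_two, co2_tmul, Module.Basis.coord_apply, tmul_add, add_tmul, tmul_smul,
      ← smul_tmul', smul_smul]
    module

theorem cOne_tmul (b : Module.Basis (Fin 2) K V) (c : (V ⊗[K] V) →ₗ[K] (V ⊗[K] V)) (x y z : V)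
    (p q r s : K)
    (h : c (x ⊗ₜ y) = p • (b 0 ⊗ₜ[K] b 0) + q • (b 0 ⊗ₜ[K] b 1)
      + r • (b 1 ⊗ₜ[K] b 0) + s • (b 1 ⊗ₜ[K] b 1)) :
    cOne K V c (x ⊗ₜ (y ⊗ₜ z)) = p • (b 0 ⊗ₜ[K] (b 0 ⊗ₜ[K] z)) + q • (b 0 ⊗ₜ[K] (b 1 ⊗ₜ[K] z))
      + r • (b 1 ⊗ₜ[K] (b 0 ⊗ₜ[K] z)) + s • (b 1 ⊗ₜ[K] (b 1 ⊗ₜ[K] z)) := by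
  simp [cOne, h, add_tmul, ← smul_tmul']

theorem cTwo_tmul (b : Module.Basis (Fin 2) K V) (c : (V ⊗[K] V) →ₗ[K] (V ⊗[K] V)) (x y z : V)
    (p q r s : K)
    (h : c (x ⊗ₜ y) = p • (b 0 ⊗ₜ[K] b 0) + q • (b 0 ⊗ₜ[K] b 1)
      + r • (b 1 ⊗ₜ[K] b 0) + s • (b 1 ⊗ₜ[K] b 1)) :
    cTwo K V c (z ⊗ₜ (x ⊗ₜ y)) = p • (z ⊗ₜ[K] (b 0 ⊗ₜ[K] b 0)) + q • (z ⊗ₜ[K] (b 0 ⊗ₜ[K] b 1))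
      + r • (z ⊗ₜ[K] (b 1 ⊗ₜ[K] b 0)) + s • (z ⊗ₜ[K] (b 1 ⊗ₜ[K] b 1)) := by
  simp [cTwo, h, tmul_add]

theorem betaOne_tmul (β : (V ⊗[K] V) →ₗ[K] V) (x y z : V) :
    betaOne K V β (x ⊗ₜ (y ⊗ₜ z)) = β (x ⊗ₜ y) ⊗ₜ z := by simp [betaOne]

theorem betaTwo_tmul (β : (V ⊗[K] V) →ₗ[K] V) (x y z : V) :
    betaTwo K V β (x ⊗ₜ (y ⊗ₜ z)) = x ⊗ₜ β (y ⊗ₜ z) := by simp [betaTwo]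

theorem ext3 (b : Module.Basis (Fin 2) K V) {M : Type*} [AddCommGroup M] [Module K M]
    (f : (V ⊗[K] (V ⊗[K] V)) →ₗ[K] M) (h : ∀ i j k, f (b i ⊗ₜ (b j ⊗ₜ b k)) = 0) : f = 0 := by
  apply Module.Basis.ext (b.tensorProduct (b.tensorProduct b))
  rintro ⟨i, j, k⟩
  simp [h]

/-- Shape of `c` : coefficients determined by the bialgebra-type axioms. -/
def Shape (b : Module.Basis (Fin 2) K V) (c : (V ⊗[K] V) →ₗ[K] (V ⊗[K] V))
    (l p q r s A B C D : K) : Prop :=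
  c (b 0 ⊗ₜ[K] b 0) = l • (b 0 ⊗ₜ[K] b 0) + (0 : K) • (b 0 ⊗ₜ[K] b 1)
      + (0 : K) • (b 1 ⊗ₜ[K] b 0) + (0 : K) • (b 1 ⊗ₜ[K] b 1) ∧
  c (b 0 ⊗ₜ[K] b 1) = q • (b 0 ⊗ₜ[K] b 0) + (0 : K) • (b 0 ⊗ₜ[K] b 1)
      + p • (b 1 ⊗ₜ[K] b 0) + (0 : K) • (b 1 ⊗ₜ[K] b 1) ∧
  c (b 1 ⊗ₜ[K] b 0) = s • (b 0 ⊗ₜ[K] b 0) + r • (b 0 ⊗ₜ[K] b 1)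
      + (0 : K) • (b 1 ⊗ₜ[K] b 0) + (0 : K) • (b 1 ⊗ₜ[K] b 1) ∧
  c (b 1 ⊗ₜ[K] b 1) = A • (b 0 ⊗ₜ[K] b 0) + B • (b 0 ⊗ₜ[K] b 1)
      + C • (b 1 ⊗ₜ[K] b 0) + D • (b 1 ⊗ₜ[K] b 1)

/-- Bracket with values in the line of `b 0`. -/
def BShape (b : Module.Basis (Fin 2) K V) (β : (V ⊗[K] V) →ₗ[K] V) (e f g h : K) : Prop :=
  β (b 0 ⊗ₜ[K] b 0) = e • b 0 ∧ β (b 0 ⊗ₜ[K] b 1) = f • b 0 ∧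
  β (b 1 ⊗ₜ[K] b 0) = g • b 0 ∧ β (b 1 ⊗ₜ[K] b 1) = h • b 0

theorem shape (b : Module.Basis (Fin 2) K V)
    (c : (V ⊗[K] V) →ₗ[K] (V ⊗[K] V)) (β : (V ⊗[K] V) →ₗ[K] V)
    (hQ : IsLiftedQLie K V c β) (e f g h : K) (hB : BShape K V b β e f g h)
    (hne : ¬ (e = 0 ∧ f = 0 ∧ g = 0 ∧ h = 0)) :
    ∃ l p q r s A B C D : K, Shape K V b c l p q r s A B C D := by
  obtain ⟨-, hB1, hB2, -, -⟩ := hQ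
  obtain ⟨h00, h01, h10, h11⟩ := hB
  have hb : ∃ i j, ∃ w : K, w ≠ 0 ∧ β (b i ⊗ₜ b j) = w • b 0 := by
    by_cases he : e = 0
    · by_cases hf : f = 0
      · by_cases hg : g = 0
        · exact ⟨1, 1, h, by tauto, h11⟩
        · exact ⟨1, 0, g, hg, h10⟩
      · exact ⟨0, 1, f, hf, h01⟩
    · exact ⟨0, 0, e, he, h00⟩
  obtain ⟨i, j, w, hw, hij⟩ := hb
  have key2 : ∀ k, co2 K V b k 1 ∘ₗ betaTwo K V β = 0 := by
    intro k
    apply ext3 K V b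
    intro i j k
    fin_cases j <;> fin_cases k <;>
      simp [betaTwo_tmul, h00, h01, h10, h11, co2_tmul]
  have key1 : ∀ k, co2 K V b 1 k ∘ₗ betaOne K V β = 0 := by
    intro k
    apply ext3 K V b
    intro i j k
    fin_cases i <;> fin_cases j <;>
      simp [betaOne_tmul, h00, h01, h10, h11, co2_tmul]
  have z2 : ∀ k d, co2 K V b k 1 (c (b 0 ⊗ₜ d)) = 0 := by
    intro k d
    have h1 := congrArg (co2 K V b k 1) (LinearMap.congr_fun hB1 (b i ⊗ₜ (b j ⊗ₜ d)))
    have h2 := LinearMap.congr_fun (key2 k) ((cOne K V c ∘ₗ cTwo K V c) (b i ⊗ₜ (b j ⊗ₜ d)))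
    simp only [LinearMap.comp_apply, LinearMap.zero_apply] at h1 h2
    rw [h2, betaOne_tmul, hij, ← smul_tmul', map_smul, map_smul, smul_eq_mul] at h1
    exact (mul_eq_zero.mp h1).resolve_left hw
  have z1 : ∀ k d, co2 K V b 1 k (c (d ⊗ₜ b 0)) = 0 := by
    intro k d
    have h1 := congrArg (co2 K V b 1 k) (LinearMap.congr_fun hB2 (d ⊗ₜ (b i ⊗ₜ b j)))
    have h2 := LinearMap.congr_fun (key1 k) ((cTwo K V c ∘ₗ cOne K V c) (d ⊗ₜ (b i ⊗ₜ b j)))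
    simp only [LinearMap.comp_apply, LinearMap.zero_apply] at h1 h2
    rw [h2, betaTwo_tmul, hij, tmul_smul, map_smul, map_smul, smul_eq_mul] at h1
    exact (mul_eq_zero.mp h1).resolve_left hw
  refine ⟨co2 K V b 0 0 (c (b 0 ⊗ₜ b 0)), co2 K V b 1 0 (c (b 0 ⊗ₜ b 1)),
    co2 K V b 0 0 (c (b 0 ⊗ₜ b 1)), co2 K V b 0 1 (c (b 1 ⊗ₜ b 0)),
    co2 K V b 0 0 (c (b 1 ⊗ₜ b 0)), _, _, _, _, ?_, ?_, ?_, expand2 K V b _⟩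
  · nth_rewrite 1 [expand2 K V b (c (b 0 ⊗ₜ b 0))]
    simp only [z1, z2]
  · nth_rewrite 1 [expand2 K V b (c (b 0 ⊗ₜ b 1))]
    simp only [z2]
  · nth_rewrite 1 [expand2 K V b (c (b 1 ⊗ₜ b 0))]
    simp only [z1]

theorem eqE (h2 : (2 : K) ≠ 0) (b : Module.Basis (Fin 2) K V)
    (c : (V ⊗[K] V) →ₗ[K] (V ⊗[K] V)) (β : (V ⊗[K] V) →ₗ[K] V)
    (hQ : IsLiftedQLie K V c β) (e f g h : K) (hB : BShape K V b β e f g h)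
    (l p q r s A B C D : K) (hS : Shape K V b c l p q r s A B C D) : e = 0 := by
  obtain ⟨-, hB1, -, -, hA⟩ := hQ
  obtain ⟨b00, b01, b10, b11⟩ := hB
  obtain ⟨c00, c01, c10, c11⟩ := hS
  have o00 := fun z => cOne_tmul K V b c _ _ z _ _ _ _ c00
  have o01 := fun z => cOne_tmul K V b c _ _ z _ _ _ _ c01
  have o10 := fun z => cOne_tmul K V b c _ _ z _ _ _ _ c10
  have o11 := fun z => cOne_tmul K V b c _ _ z _ _ _ _ c11
  have t00 := fun z => cTwo_tmul K V b c _ _ z _ _ _ _ c00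
  have t01 := fun z => cTwo_tmul K V b c _ _ z _ _ _ _ c01
  have t10 := fun z => cTwo_tmul K V b c _ _ z _ _ _ _ c10
  have t11 := fun z => cTwo_tmul K V b c _ _ z _ _ _ _ c11
  have h1 := congrArg (co2 K V b 0 0) (LinearMap.congr_fun hB1 (b 0 ⊗ₜ (b 0 ⊗ₜ b 0)))
  simp [LinearMap.comp_apply, map_add, map_smul, betaOne_tmul, betaTwo_tmul, b00, b01, b10, b11, o00, o01,
    o10, o11, t00, t01, t10, t11, tmul_smul, ← smul_tmul', c00, c01, c10, c11, co2_tmul, co3_tmul] at h1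
  have h3 := congrArg (b.coord 0) (LinearMap.congr_fun hA (b 0 ⊗ₜ b 0))
  simp [c00, b00] at h3
  have : 2 * e = 0 := by grind
  exact (mul_eq_zero.mp this).resolve_left h2

theorem eqsA (b : Module.Basis (Fin 2) K V)
    (c : (V ⊗[K] V) →ₗ[K] (V ⊗[K] V)) (β : (V ⊗[K] V) →ₗ[K] V)
    (hQ : IsLiftedQLie K V c β) (f g h : K) (hB : BShape K V b β 0 f g h)
    (l p q r s A B C D : K) (hS : Shape K V b c l p q r s A B C D) :
    p * g = - f ∧ r * f = - g ∧ B * f + C * g + D * h = - h := by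
  obtain ⟨-, -, -, -, hA⟩ := hQ
  obtain ⟨b00, b01, b10, b11⟩ := hB
  obtain ⟨c00, c01, c10, c11⟩ := hS
  have h1 := congrArg (b.coord 0) (LinearMap.congr_fun hA (b 0 ⊗ₜ b 1))
  have h2 := congrArg (b.coord 0) (LinearMap.congr_fun hA (b 1 ⊗ₜ b 0))
  have h3 := congrArg (b.coord 0) (LinearMap.congr_fun hA (b 1 ⊗ₜ b 1))
  simp [c00, c01, c10, c11, b00, b01, b10, b11] at h1 h2 h3
  exact ⟨h1, h2, h3⟩

theorem eqsB1 (b : Module.Basis (Fin 2) K V)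
    (c : (V ⊗[K] V) →ₗ[K] (V ⊗[K] V)) (β : (V ⊗[K] V) →ₗ[K] V)
    (hQ : IsLiftedQLie K V c β) (f g h : K) (hB : BShape K V b β 0 f g h)
    (l p q r s A B C D : K) (hS : Shape K V b c l p q r s A B C D) :
    f * l = r * (l * f) ∧
    g * l = l * (r * g) ∧
    g * q = q * (r * g) + p * (B * g) ∧
    g * p = p * (D * g) ∧
    h * l = s * (r * g) + (r * (s * f) + r * (r * h)) ∧
    h * q = A * (r * g) + (B * (s * f) + B * (r * h)) + C * (B * g) + (D * (A * f) + D * (B * h)) ∧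
    h * p = C * (D * g) + (D * (C * f) + D * (D * h)) := by
  obtain ⟨-, hB1, -, -, -⟩ := hQ
  obtain ⟨b00, b01, b10, b11⟩ := hB
  obtain ⟨c00, c01, c10, c11⟩ := hS
  have o00 := fun z => cOne_tmul K V b c _ _ z _ _ _ _ c00
  have o01 := fun z => cOne_tmul K V b c _ _ z _ _ _ _ c01
  have o10 := fun z => cOne_tmul K V b c _ _ z _ _ _ _ c10
  have o11 := fun z => cOne_tmul K V b c _ _ z _ _ _ _ c11
  have t00 := fun z => cTwo_tmul K V b c _ _ z _ _ _ _ c00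
  have t01 := fun z => cTwo_tmul K V b c _ _ z _ _ _ _ c01
  have t10 := fun z => cTwo_tmul K V b c _ _ z _ _ _ _ c10
  have t11 := fun z => cTwo_tmul K V b c _ _ z _ _ _ _ c11
  refine ⟨?_, ?_, ?_, ?_, ?_, ?_, ?_⟩
  · have h1 := congrArg (co2 K V b 0 0) (LinearMap.congr_fun hB1 (b 0 ⊗ₜ (b 1 ⊗ₜ b 0)))
    simpa [LinearMap.comp_apply, map_add, map_smul, betaOne_tmul, betaTwo_tmul, b00, b01, b10, b11, o00, o01,
    o10, o11, t00, t01, t10, t11, tmul_smul, ← smul_tmul', c00, c01, c10, c11, co2_tmul, co3_tmul] using h1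
  · have h1 := congrArg (co2 K V b 0 0) (LinearMap.congr_fun hB1 (b 1 ⊗ₜ (b 0 ⊗ₜ b 0)))
    simpa [LinearMap.comp_apply, map_add, map_smul, betaOne_tmul, betaTwo_tmul, b00, b01, b10, b11, o00, o01,
    o10, o11, t00, t01, t10, t11, tmul_smul, ← smul_tmul', c00, c01, c10, c11, co2_tmul, co3_tmul] using h1
  · have h1 := congrArg (co2 K V b 0 0) (LinearMap.congr_fun hB1 (b 1 ⊗ₜ (b 0 ⊗ₜ b 1)))
    simpa [LinearMap.comp_apply, map_add, map_smul, betaOne_tmul, betaTwo_tmul, b00, b01, b10, b11, o00, o01,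
    o10, o11, t00, t01, t10, t11, tmul_smul, ← smul_tmul', c00, c01, c10, c11, co2_tmul, co3_tmul] using h1
  · have h1 := congrArg (co2 K V b 1 0) (LinearMap.congr_fun hB1 (b 1 ⊗ₜ (b 0 ⊗ₜ b 1)))
    simpa [LinearMap.comp_apply, map_add, map_smul, betaOne_tmul, betaTwo_tmul, b00, b01, b10, b11, o00, o01,
    o10, o11, t00, t01, t10, t11, tmul_smul, ← smul_tmul', c00, c01, c10, c11, co2_tmul, co3_tmul] using h1
  · have h1 := congrArg (co2 K V b 0 0) (LinearMap.congr_fun hB1 (b 1 ⊗ₜ (b 1 ⊗ₜ b 0)))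
    simpa [LinearMap.comp_apply, map_add, map_smul, betaOne_tmul, betaTwo_tmul, b00, b01, b10, b11, o00, o01,
    o10, o11, t00, t01, t10, t11, tmul_smul, ← smul_tmul', c00, c01, c10, c11, co2_tmul, co3_tmul] using h1
  · have h1 := congrArg (co2 K V b 0 0) (LinearMap.congr_fun hB1 (b 1 ⊗ₜ (b 1 ⊗ₜ b 1)))
    simpa [LinearMap.comp_apply, map_add, map_smul, betaOne_tmul, betaTwo_tmul, b00, b01, b10, b11, o00, o01,
    o10, o11, t00, t01, t10, t11, tmul_smul, ← smul_tmul', c00, c01, c10, c11, co2_tmul, co3_tmul] using h1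
  · have h1 := congrArg (co2 K V b 1 0) (LinearMap.congr_fun hB1 (b 1 ⊗ₜ (b 1 ⊗ₜ b 1)))
    simpa [LinearMap.comp_apply, map_add, map_smul, betaOne_tmul, betaTwo_tmul, b00, b01, b10, b11, o00, o01,
    o10, o11, t00, t01, t10, t11, tmul_smul, ← smul_tmul', c00, c01, c10, c11, co2_tmul, co3_tmul] using h1

theorem eqsB2 (b : Module.Basis (Fin 2) K V)
    (c : (V ⊗[K] V) →ₗ[K] (V ⊗[K] V)) (β : (V ⊗[K] V) →ₗ[K] V)
    (hQ : IsLiftedQLie K V c β) (f g h : K) (hB : BShape K V b β 0 f g h)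
    (l p q r s A B C D : K) (hS : Shape K V b c l p q r s A B C D) :
    h * l = q * (p * f) + (p * (q * g) + p * (p * h)) ∧
    f * s = s * (p * f) + r * (C * f) ∧
    h * s = A * (p * f) + B * (C * f) + (C * (q * g) + C * (p * h)) + (D * (A * g) + D * (C * h)) ∧
    h * r = B * (D * f) + (D * (B * g) + D * (D * h)) := by
  obtain ⟨-, -, hB2, -, -⟩ := hQ
  obtain ⟨b00, b01, b10, b11⟩ := hB
  obtain ⟨c00, c01, c10, c11⟩ := hS
  have o00 := fun z => cOne_tmul K V b c _ _ z _ _ _ _ c00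
  have o01 := fun z => cOne_tmul K V b c _ _ z _ _ _ _ c01
  have o10 := fun z => cOne_tmul K V b c _ _ z _ _ _ _ c10
  have o11 := fun z => cOne_tmul K V b c _ _ z _ _ _ _ c11
  have t00 := fun z => cTwo_tmul K V b c _ _ z _ _ _ _ c00
  have t01 := fun z => cTwo_tmul K V b c _ _ z _ _ _ _ c01
  have t10 := fun z => cTwo_tmul K V b c _ _ z _ _ _ _ c10
  have t11 := fun z => cTwo_tmul K V b c _ _ z _ _ _ _ c11
  refine ⟨?_, ?_, ?_, ?_⟩
  · have h1 := congrArg (co2 K V b 0 0) (LinearMap.congr_fun hB2 (b 0 ⊗ₜ (b 1 ⊗ₜ b 1)))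
    simpa [LinearMap.comp_apply, map_add, map_smul, betaOne_tmul, betaTwo_tmul, b00, b01, b10, b11, o00, o01,
    o10, o11, t00, t01, t10, t11, tmul_smul, ← smul_tmul', c00, c01, c10, c11, co2_tmul, co3_tmul] using h1
  · have h1 := congrArg (co2 K V b 0 0) (LinearMap.congr_fun hB2 (b 1 ⊗ₜ (b 0 ⊗ₜ b 1)))
    simpa [LinearMap.comp_apply, map_add, map_smul, betaOne_tmul, betaTwo_tmul, b00, b01, b10, b11, o00, o01,
    o10, o11, t00, t01, t10, t11, tmul_smul, ← smul_tmul', c00, c01, c10, c11, co2_tmul, co3_tmul] using h1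
  · have h1 := congrArg (co2 K V b 0 0) (LinearMap.congr_fun hB2 (b 1 ⊗ₜ (b 1 ⊗ₜ b 1)))
    simpa [LinearMap.comp_apply, map_add, map_smul, betaOne_tmul, betaTwo_tmul, b00, b01, b10, b11, o00, o01,
    o10, o11, t00, t01, t10, t11, tmul_smul, ← smul_tmul', c00, c01, c10, c11, co2_tmul, co3_tmul] using h1
  · have h1 := congrArg (co2 K V b 0 1) (LinearMap.congr_fun hB2 (b 1 ⊗ₜ (b 1 ⊗ₜ b 1)))
    simpa [LinearMap.comp_apply, map_add, map_smul, betaOne_tmul, betaTwo_tmul, b00, b01, b10, b11, o00, o01,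
    o10, o11, t00, t01, t10, t11, tmul_smul, ← smul_tmul', c00, c01, c10, c11, co2_tmul, co3_tmul] using h1

theorem eqsY (b : Module.Basis (Fin 2) K V)
    (c : (V ⊗[K] V) →ₗ[K] (V ⊗[K] V)) (β : (V ⊗[K] V) →ₗ[K] V)
    (hQ : IsLiftedQLie K V c β) (f g h : K) (hB : BShape K V b β 0 f g h)
    (l p q r s A B C D : K) (hS : Shape K V b c l p q r s A B C D) :
    q * (q * l) + q * (p * q) + (p * (q * s) + p * (p * A)) = A * (l * l) + B * (l * q) + C * (q * l) + D * (q * q) ∧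
    A * (l * l) + B * (s * l) + C * (l * s) + D * (s * s) = s * (s * l) + s * (r * s) + (r * (s * q) + r * (r * A)) ∧
    q * (l * l) + p * (l * s) = s * (l * l) + r * (l * q) ∧
    A * (q * l) + A * (p * q) + (B * (A * l) + B * (C * q)) + (C * (q * s) + C * (p * A)) + (D * (A * s) + D * (C * A)) =
      A * (s * l) + A * (r * s) + (B * (s * q) + B * (r * A)) + (C * (A * l) + C * (B * s)) + (D * (A * q) + D * (B * A)) ∧
    B * (D * p) + D * (D * C) = C * (D * r) + D * (D * B) := by
  obtain ⟨hY, -, -, -, -⟩ := hQ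
  obtain ⟨b00, b01, b10, b11⟩ := hB
  obtain ⟨c00, c01, c10, c11⟩ := hS
  have o00 := fun z => cOne_tmul K V b c _ _ z _ _ _ _ c00
  have o01 := fun z => cOne_tmul K V b c _ _ z _ _ _ _ c01
  have o10 := fun z => cOne_tmul K V b c _ _ z _ _ _ _ c10
  have o11 := fun z => cOne_tmul K V b c _ _ z _ _ _ _ c11
  have t00 := fun z => cTwo_tmul K V b c _ _ z _ _ _ _ c00
  have t01 := fun z => cTwo_tmul K V b c _ _ z _ _ _ _ c01
  have t10 := fun z => cTwo_tmul K V b c _ _ z _ _ _ _ c10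
  have t11 := fun z => cTwo_tmul K V b c _ _ z _ _ _ _ c11
  refine ⟨?_, ?_, ?_, ?_, ?_⟩
  · have h1 := congrArg (co3 K V b 0 0 0) (LinearMap.congr_fun hY (b 0 ⊗ₜ (b 1 ⊗ₜ b 1)))
    simpa [LinearMap.comp_apply, map_add, map_smul, betaOne_tmul, betaTwo_tmul, b00, b01, b10, b11, o00, o01,
    o10, o11, t00, t01, t10, t11, tmul_smul, ← smul_tmul', c00, c01, c10, c11, co2_tmul, co3_tmul] using h1
  · have h1 := congrArg (co3 K V b 0 0 0) (LinearMap.congr_fun hY (b 1 ⊗ₜ (b 1 ⊗ₜ b 0)))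
    simpa [LinearMap.comp_apply, map_add, map_smul, betaOne_tmul, betaTwo_tmul, b00, b01, b10, b11, o00, o01,
    o10, o11, t00, t01, t10, t11, tmul_smul, ← smul_tmul', c00, c01, c10, c11, co2_tmul, co3_tmul] using h1
  · have h1 := congrArg (co3 K V b 0 0 0) (LinearMap.congr_fun hY (b 0 ⊗ₜ (b 1 ⊗ₜ b 0)))
    simpa [LinearMap.comp_apply, map_add, map_smul, betaOne_tmul, betaTwo_tmul, b00, b01, b10, b11, o00, o01,
    o10, o11, t00, t01, t10, t11, tmul_smul, ← smul_tmul', c00, c01, c10, c11, co2_tmul, co3_tmul] using h1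
  · have h1 := congrArg (co3 K V b 0 0 0) (LinearMap.congr_fun hY (b 1 ⊗ₜ (b 1 ⊗ₜ b 1)))
    simpa [LinearMap.comp_apply, map_add, map_smul, betaOne_tmul, betaTwo_tmul, b00, b01, b10, b11, o00, o01,
    o10, o11, t00, t01, t10, t11, tmul_smul, ← smul_tmul', c00, c01, c10, c11, co2_tmul, co3_tmul] using h1
  · have h1 := congrArg (co3 K V b 1 0 1) (LinearMap.congr_fun hY (b 1 ⊗ₜ (b 1 ⊗ₜ b 1)))
    simpa [LinearMap.comp_apply, map_add, map_smul, betaOne_tmul, betaTwo_tmul, b00, b01, b10, b11, o00, o01,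
    o10, o11, t00, t01, t10, t11, tmul_smul, ← smul_tmul', c00, c01, c10, c11, co2_tmul, co3_tmul] using h1

/-- The conclusion of the classification. -/
def Concl (c : (V ⊗[K] V) →ₗ[K] (V ⊗[K] V)) (β : (V ⊗[K] V) →ₗ[K] V) : Prop :=
    ∃ (b : Module.Basis (Fin 2) K V) (γ : K),
      -- (1) the flip
      ((∀ i j : Fin 2, c (b i ⊗ₜ[K] b j) = b j ⊗ₜ[K] b i) ∧ BetaStd K V b β) ∨
      -- (2)
      (c (b 0 ⊗ₜ[K] b 0) = b 0 ⊗ₜ[K] b 0 ∧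
        c (b 1 ⊗ₜ[K] b 0) = b 0 ⊗ₜ[K] b 0 + b 0 ⊗ₜ[K] b 1 ∧
        c (b 0 ⊗ₜ[K] b 1) = - (b 0 ⊗ₜ[K] b 0) + b 1 ⊗ₜ[K] b 0 ∧
        c (b 1 ⊗ₜ[K] b 1) = b 1 ⊗ₜ[K] b 1 ∧ BetaStd K V b β) ∨
      -- (3)
      (c (b 0 ⊗ₜ[K] b 0) = - (b 0 ⊗ₜ[K] b 0) ∧
        c (b 1 ⊗ₜ[K] b 0) = b 0 ⊗ₜ[K] b 1 ∧
        c (b 0 ⊗ₜ[K] b 1) = b 1 ⊗ₜ[K] b 0 ∧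
        c (b 1 ⊗ₜ[K] b 1) = γ • (b 0 ⊗ₜ[K] b 0) + b 1 ⊗ₜ[K] b 1 ∧
        (γ = 0 ∨ γ = 1 ∨ ¬ ∃ s : K, s ^ 2 = γ) ∧ BetaStd K V b β) ∨
      -- (4)
      (c (b 0 ⊗ₜ[K] b 0) = b 0 ⊗ₜ[K] b 0 ∧
        c (b 1 ⊗ₜ[K] b 0) = b 0 ⊗ₜ[K] b 1 ∧
        c (b 0 ⊗ₜ[K] b 1) = b 1 ⊗ₜ[K] b 0 ∧
        c (b 1 ⊗ₜ[K] b 1) = γ • (b 0 ⊗ₜ[K] b 0) - b 1 ⊗ₜ[K] b 1 ∧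
        (γ = 0 ∨ γ = 1 ∨ ¬ ∃ s : K, s ^ 2 = γ) ∧
        β (b 0 ⊗ₜ[K] b 0) = 0 ∧ β (b 1 ⊗ₜ[K] b 0) = 0 ∧
        β (b 0 ⊗ₜ[K] b 1) = 0 ∧ β (b 1 ⊗ₜ[K] b 1) = b 0) ∨
      -- (5)
      (c (b 0 ⊗ₜ[K] b 0) = 0 ∧
        c (b 1 ⊗ₜ[K] b 0) = b 0 ⊗ₜ[K] b 0 + b 0 ⊗ₜ[K] b 1 ∧
        c (b 0 ⊗ₜ[K] b 1) = b 1 ⊗ₜ[K] b 0 ∧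
        c (b 1 ⊗ₜ[K] b 1) = b 1 ⊗ₜ[K] b 1 ∧ BetaStd K V b β) ∨
      -- (6)
      (c (b 0 ⊗ₜ[K] b 0) = 0 ∧
        c (b 1 ⊗ₜ[K] b 0) = γ⁻¹ • (b 0 ⊗ₜ[K] b 1) ∧
        c (b 0 ⊗ₜ[K] b 1) = γ • (b 1 ⊗ₜ[K] b 0) ∧
        c (b 1 ⊗ₜ[K] b 1) = b 1 ⊗ₜ[K] b 1 ∧
        γ ≠ 0 ∧ γ ≠ 1 ∧
        β (b 0 ⊗ₜ[K] b 0) = 0 ∧ β (b 1 ⊗ₜ[K] b 0) = b 0 ∧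
        β (b 0 ⊗ₜ[K] b 1) = - (γ • b 0) ∧ β (b 1 ⊗ₜ[K] b 1) = 0) ∨
      -- (7)
      (c (b 0 ⊗ₜ[K] b 0) = γ • (b 0 ⊗ₜ[K] b 0) ∧
        c (b 1 ⊗ₜ[K] b 0) = b 0 ⊗ₜ[K] b 1 ∧
        c (b 0 ⊗ₜ[K] b 1) = b 1 ⊗ₜ[K] b 0 ∧
        c (b 1 ⊗ₜ[K] b 1) = b 1 ⊗ₜ[K] b 1 ∧
        γ ≠ 1 ∧ γ ≠ -1 ∧ BetaStd K V b β) ∨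
      -- (8)
      (c (b 0 ⊗ₜ[K] b 0) = b 0 ⊗ₜ[K] b 0 ∧
        c (b 1 ⊗ₜ[K] b 0) = b 0 ⊗ₜ[K] b 1 ∧
        c (b 0 ⊗ₜ[K] b 1) = b 1 ⊗ₜ[K] b 0 ∧
        c (b 1 ⊗ₜ[K] b 1) = γ • (b 0 ⊗ₜ[K] b 0) + b 1 ⊗ₜ[K] b 1 ∧
        (γ = 1 ∨ ¬ ∃ s : K, s ^ 2 = γ) ∧ BetaStd K V b β)

theorem exists_sq (a : K) :
    ∃ u γ : K, u ≠ 0 ∧ a = γ * u ^ 2 ∧ (γ = 0 ∨ γ = 1 ∨ ¬ ∃ s : K, s ^ 2 = γ) := by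
  by_cases ha : a = 0
  · exact ⟨1, 0, one_ne_zero, by simp [ha], Or.inl rfl⟩
  by_cases hs : ∃ s : K, s ^ 2 = a
  · obtain ⟨s, hs⟩ := hs
    refine ⟨s, 1, ?_, by simp [hs], Or.inr (Or.inl rfl)⟩
    rintro rfl
    exact ha (by simpa using hs.symm)
  · exact ⟨1, a, one_ne_zero, by simp, Or.inr (Or.inr hs)⟩

theorem caseI (h2 : (2 : K) ≠ 0) (b : Module.Basis (Fin 2) K V)
    (c : (V ⊗[K] V) →ₗ[K] (V ⊗[K] V)) (β : (V ⊗[K] V) →ₗ[K] V)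
    (hQ : IsLiftedQLie K V c β) (h : K) (hh : h ≠ 0) (hB : BShape K V b β 0 0 0 h)
    (l p q r s A B C D : K) (hS : Shape K V b c l p q r s A B C D) : Concl K V c β := by
  obtain ⟨-, -, a3⟩ := eqsA K V b c β hQ _ _ _ hB _ _ _ _ _ _ _ _ _ hS
  obtain ⟨-, -, -, -, e1, e2, e3⟩ := eqsB1 K V b c β hQ _ _ _ hB _ _ _ _ _ _ _ _ _ hS
  obtain ⟨-, -, f2, f3⟩ := eqsB2 K V b c β hQ _ _ _ hB _ _ _ _ _ _ _ _ _ hS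
  obtain ⟨-, -, -, -, y⟩ := eqsY K V b c β hQ _ _ _ hB _ _ _ _ _ _ _ _ _ hS
  have hD : D = -1 := by
    apply mul_right_cancel₀ hh; linear_combination a3
  subst hD
  have hp : p = 1 := by
    apply mul_left_cancel₀ hh; linear_combination e3
  subst hp
  have hr : r = 1 := by
    apply mul_left_cancel₀ hh; linear_combination f3
  subst hr
  have hl : l = 1 := by
    apply mul_left_cancel₀ hh; linear_combination e1
  subst hl
  have hq : q = 0 := by
    apply mul_left_cancel₀ hh; linear_combination e2
  subst hq
  have hs : s = 0 := by
    apply mul_left_cancel₀ hh; linear_combination f2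
  subst hs
  have hC : C = B := by
    apply mul_left_cancel₀ h2; linear_combination y
  subst hC
  obtain ⟨v, γ, hv, hγ, hγ'⟩ := exists_sq K ((A + C ^ 2 / 2) / h ^ 2)
  have hA : A = γ * v ^ 2 * h ^ 2 - C ^ 2 / 2 := by
    rw [← hγ]; field_simp; ring
  obtain ⟨b', b0, b1⟩ := newBasis K V b (v ^ 2 * h) v (-(v * C / 2))
    (mul_ne_zero (pow_ne_zero _ hv) hh) hv
  obtain ⟨c00, c01, c10, c11⟩ := hS
  obtain ⟨b00, b01, b10, b11⟩ := hB
  refine ⟨b', γ, Or.inr (Or.inr (Or.inr (Or.inl ⟨?_, ?_, ?_, ?_, hγ', ?_, ?_, ?_, ?_⟩)))⟩ <;>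
  simp only [b0, b1, tmul_add, add_tmul, tmul_smul, ← smul_tmul', map_add, map_smul,
    c00, c01, c10, c11, b00, b01, b10, b11, hA] <;> match_scalars <;> field_simp <;> ring

theorem caseIIa (b : Module.Basis (Fin 2) K V)
    (c : (V ⊗[K] V) →ₗ[K] (V ⊗[K] V)) (β : (V ⊗[K] V) →ₗ[K] V)
    (hQ : IsLiftedQLie K V c β) (f : K) (hf : f ≠ 0) (hf1 : f ≠ -1) (hB : BShape K V b β 0 f 1 0)
    (l p q r s A B C D : K) (hS : Shape K V b c l p q r s A B C D) : Concl K V c β := by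
  obtain ⟨a1, a2, a3⟩ := eqsA K V b c β hQ _ _ _ hB _ _ _ _ _ _ _ _ _ hS
  obtain ⟨e1, e2, e3, e4, e5, e6, e7⟩ := eqsB1 K V b c β hQ _ _ _ hB _ _ _ _ _ _ _ _ _ hS
  obtain ⟨f0, f1, f2, f3⟩ := eqsB2 K V b c β hQ _ _ _ hB _ _ _ _ _ _ _ _ _ hS
  obtain ⟨y1, y2, y3, y4, y5⟩ := eqsY K V b c β hQ _ _ _ hB _ _ _ _ _ _ _ _ _ hS
  have hp0 : p ≠ 0 := by grind
  have hp1 : p ≠ 1 := by grind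
  have hfp : f = -p := by linear_combination a1
  subst hfp
  have hr : r = p⁻¹ := by
    field_simp; linear_combination -a2
  have hr1 : r ≠ 1 := by
    intro hr1; apply hp1; rw [hr1] at a2; linear_combination -a2
  have hl : l = 0 := by
    have : l * (r - 1) = 0 := by linear_combination -e2
    exact (mul_eq_zero.mp this).resolve_right (sub_ne_zero.mpr hr1)
  subst hl
  have hs : s = 0 := by
    have : (r * (1 - p)) * s = 0 := by linear_combination -e5
    refine (mul_eq_zero.mp this).resolve_left (mul_ne_zero ?_ (sub_ne_zero.mpr (Ne.symm hp1)))
    rw [hr]; exact inv_ne_zero hp0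
  subst hs
  have hq : q = 0 := by
    have : (p * (1 - p)) * q = 0 := by linear_combination -f0
    exact (mul_eq_zero.mp this).resolve_left (mul_ne_zero hp0 (sub_ne_zero.mpr (Ne.symm hp1)))
  subst hq
  have hBz : B = 0 := by
    have : p * B = 0 := by linear_combination -e3
    exact (mul_eq_zero.mp this).resolve_left hp0
  subst hBz
  have hC : C = 0 := by linear_combination a3
  subst hC
  have hD : D = 1 := by
    apply mul_left_cancel₀ hp0; linear_combination -e4
  subst hD
  have hA : A = 0 := by
    have : (p * p) * A = 0 := by linear_combination y1
    exact (mul_eq_zero.mp this).resolve_left (mul_ne_zero hp0 hp0)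
  subst hA
  subst hr
  obtain ⟨c00, c01, c10, c11⟩ := hS
  obtain ⟨b00, b01, b10, b11⟩ := hB
  refine ⟨b, p, Or.inr (Or.inr (Or.inr (Or.inr (Or.inr (Or.inl
    ⟨?_, ?_, ?_, ?_, hp0, hp1, ?_, ?_, ?_, ?_⟩)))))⟩ <;>
  simp [c00, c01, c10, c11, b00, b01, b10, b11]

theorem caseIIb (h2 : (2 : K) ≠ 0) (b : Module.Basis (Fin 2) K V)
    (c : (V ⊗[K] V) →ₗ[K] (V ⊗[K] V)) (β : (V ⊗[K] V) →ₗ[K] V)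
    (hQ : IsLiftedQLie K V c β) (h : K) (hB : BShape K V b β 0 (-1) 1 h)
    (l p q r s A B C D : K) (hS : Shape K V b c l p q r s A B C D) : Concl K V c β := by
  obtain ⟨a1, a2, a3⟩ := eqsA K V b c β hQ _ _ _ hB _ _ _ _ _ _ _ _ _ hS
  obtain ⟨e1, e2, e3, e4, e5, e6, e7⟩ := eqsB1 K V b c β hQ _ _ _ hB _ _ _ _ _ _ _ _ _ hS
  obtain ⟨f0, f1, f2, f3⟩ := eqsB2 K V b c β hQ _ _ _ hB _ _ _ _ _ _ _ _ _ hS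
  obtain ⟨y1, y2, y3, y4, y5⟩ := eqsY K V b c β hQ _ _ _ hB _ _ _ _ _ _ _ _ _ hS
  have hp : p = 1 := by linear_combination a1
  subst hp
  have hr : r = 1 := by linear_combination -a2
  subst hr
  have hBz : B = 0 := by linear_combination -e3
  subst hBz
  have hC : C = 0 := by linear_combination f1
  subst hC
  have hD : D = 1 := by linear_combination -e4
  subst hD
  have hh : h = 0 := by
    apply mul_left_cancel₀ h2; linear_combination a3
  subst hh
  clear a1 a2 a3 e1 e2 e3 e4 e5 e6 e7 f0 f1 f2 f3 y5
  obtain ⟨c00, c01, c10, c11⟩ := hS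
  obtain ⟨b00, b01, b10, b11⟩ := hB
  by_cases hl : l = 1
  · subst hl
    have hqs : s = -q := by
      by_cases hq : q = 0
      · subst hq
        have : s * s = 0 := by linear_combination -y2
        simpa using this
      · have : q * (s + q) = 0 := by linear_combination y1
        have := (mul_eq_zero.mp this).resolve_left hq
        linear_combination this
    subst hqs
    have hAq : A = 0 ∨ q = 0 := by
      have : 2 * (A * q) = 0 := by
        linear_combination y4
      have := (mul_eq_zero.mp this).resolve_left h2
      exact mul_eq_zero.mp this
    by_cases hq : q = 0
    · subst hq
      by_cases hA : A = 0
      · subst hA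
        refine ⟨b, 0, Or.inl ⟨?_, ?_, ?_, ?_, ?_⟩⟩
        · intro i j
          fin_cases i <;> fin_cases j <;> simp [c00, c01, c10, c11]
        all_goals simp [b00, b01, b10, b11]
      · obtain ⟨u, γ, hu, hγ, hγ'⟩ := exists_sq K A
        have hγ0 : γ ≠ 0 := by
          rintro rfl
          exact hA (by simpa using hγ)
        obtain ⟨b', b0, b1⟩ := newBasis K V b u 1 0 hu one_ne_zero
        refine ⟨b', γ, Or.inr (Or.inr (Or.inr (Or.inr (Or.inr (Or.inr (Or.inr
          ⟨?_, ?_, ?_, ?_, hγ'.resolve_left hγ0, ?_, ?_, ?_, ?_⟩))))))⟩ <;>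
        simp only [b0, b1, tmul_add, add_tmul, tmul_smul, ← smul_tmul', map_add, map_smul,
          c00, c01, c10, c11, b00, b01, b10, b11, hγ] <;> match_scalars <;> ring
    · have hA := hAq.resolve_right hq
      subst hA
      obtain ⟨b', b0, b1⟩ := newBasis K V b (-q) 1 0 (neg_ne_zero.mpr hq) one_ne_zero
      refine ⟨b', 0, Or.inr (Or.inl ⟨?_, ?_, ?_, ?_, ?_, ?_, ?_, ?_⟩)⟩ <;>
      simp only [b0, b1, tmul_add, add_tmul, tmul_smul, ← smul_tmul', map_add, map_smul,
          c00, c01, c10, c11, b00, b01, b10, b11] <;> match_scalars <;> ring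
  have hl' : 1 - l ≠ 0 := sub_ne_zero.mpr (Ne.symm hl)
  obtain ⟨t, ht⟩ : ∃ t, q = t * (1 - l) := ⟨q / (1 - l), by field_simp⟩
  have hlsq : l * (s - q) = 0 := by
    apply mul_left_cancel₀ hl'; linear_combination y3
  have hA' : (A + t * s) * (1 + l) = 0 := by
    apply mul_left_cancel₀ hl'
    linear_combination y1 - s * (1 + l) * ht + q * hlsq
  by_cases hl1 : l = -1
  · subst hl1
    have hs : s = q := by linear_combination -hlsq
    subst hs
    obtain ⟨u, γ, hu, hγ, hγ'⟩ := exists_sq K (A + t * s)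
    have hA : A = γ * u ^ 2 - t * s := by linear_combination hγ
    obtain ⟨b', b0, b1⟩ := newBasis K V b u 1 t hu one_ne_zero
    refine ⟨b', γ, Or.inr (Or.inr (Or.inl
          ⟨?_, ?_, ?_, ?_, hγ', ?_, ?_, ?_, ?_⟩))⟩ <;>
    simp only [b0, b1, tmul_add, add_tmul, tmul_smul, ← smul_tmul', map_add, map_smul,
          c00, c01, c10, c11, b00, b01, b10, b11, hA] <;> match_scalars <;> clear hQ y1 y2 y3 y4 hA' hlsq c00 c01 c10 c11 b00 b01 b10 b11 b0 b1 <;> grind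
  have hl1' : 1 + l ≠ 0 := by
    intro h; apply hl1; linear_combination h
  have hA : A = - (t * s) := by
    have := (mul_eq_zero.mp hA').resolve_right hl1'
    linear_combination this
  by_cases hs : s = q
  · subst hs
    obtain ⟨b', b0, b1⟩ := newBasis K V b 1 1 t one_ne_zero one_ne_zero
    refine ⟨b', l, Or.inr (Or.inr (Or.inr (Or.inr (Or.inr (Or.inr (Or.inl
          ⟨?_, ?_, ?_, ?_, hl, hl1, ?_, ?_, ?_, ?_⟩))))))⟩ <;>
    simp only [b0, b1, tmul_add, add_tmul, tmul_smul, ← smul_tmul', map_add, map_smul,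
          c00, c01, c10, c11, b00, b01, b10, b11, hA] <;> match_scalars <;> clear hQ y1 y2 y3 y4 hA' hlsq c00 c01 c10 c11 b00 b01 b10 b11 b0 b1 <;> grind
  · have hs' : s - q ≠ 0 := sub_ne_zero.mpr hs
    have hl0 : l = 0 := (mul_eq_zero.mp hlsq).resolve_right hs'
    subst hl0
    obtain ⟨b', b0, b1⟩ := newBasis K V b (s - q) 1 t hs' one_ne_zero
    refine ⟨b', 0, Or.inr (Or.inr (Or.inr (Or.inr (Or.inl
          ⟨?_, ?_, ?_, ?_, ?_, ?_, ?_, ?_⟩))))⟩ <;>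
    simp only [b0, b1, tmul_add, add_tmul, tmul_smul, ← smul_tmul', map_add, map_smul,
          c00, c01, c10, c11, b00, b01, b10, b11, hA] <;> match_scalars <;> clear hQ y1 y2 y3 y4 hA' hlsq c00 c01 c10 c11 b00 b01 b10 b11 b0 b1 <;> grind

theorem main (h2 : (2 : K) ≠ 0)
    (c : (V ⊗[K] V) →ₗ[K] (V ⊗[K] V)) (β : (V ⊗[K] V) →ₗ[K] V)
    (hQ : IsLiftedQLie K V c β)
    (hdim : Module.finrank K V = 2)
    (hβ : β ≠ 0)
    (him : Module.finrank K (LinearMap.range β) = 1) : Concl K V c β := by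
  obtain ⟨⟨x, hx⟩, hx0, hspan⟩ := finrank_eq_one_iff'.mp him
  have hx0' : x ≠ 0 := by simpa using hx0
  have hsp : ∀ z, ∃ w : K, β z = w • x := by
    intro z
    obtain ⟨w, hw⟩ := hspan ⟨β z, z, rfl⟩
    exact ⟨w, by simpa using (congrArg Subtype.val hw).symm⟩
  obtain ⟨b, hb⟩ : ∃ b : Module.Basis (Fin 2) K V, b 0 = x := by
    obtain ⟨y, hy⟩ := exists_linearIndependent_pair_of_one_lt_finrank
      (R := K) (M := V) (by omega) hx0'
    exact ⟨basisOfLinearIndependentOfCardEqFinrank hy (by simp [hdim]), by simp⟩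
  subst hb
  choose w hw using hsp
  have hB : BShape K V b β (w (b 0 ⊗ₜ b 0)) (w (b 0 ⊗ₜ b 1)) (w (b 1 ⊗ₜ b 0)) (w (b 1 ⊗ₜ b 1)) :=
    ⟨hw _, hw _, hw _, hw _⟩
  generalize w (b 0 ⊗ₜ b 0) = e, w (b 0 ⊗ₜ b 1) = f, w (b 1 ⊗ₜ b 0) = g,
    w (b 1 ⊗ₜ b 1) = h at hB
  have hne : ¬ (e = 0 ∧ f = 0 ∧ g = 0 ∧ h = 0) := by
    rintro ⟨rfl, rfl, rfl, rfl⟩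
    obtain ⟨b00, b01, b10, b11⟩ := hB
    apply hβ
    apply Module.Basis.ext (b.tensorProduct b)
    rintro ⟨i, j⟩
    fin_cases i <;> fin_cases j <;> simp [b00, b01, b10, b11]
  obtain ⟨l, p, q, r, s, A, B, C, D, hS⟩ := shape K V b c β hQ e f g h hB hne
  have he := eqE K V h2 b c β hQ _ _ _ _ hB _ _ _ _ _ _ _ _ _ hS
  subst he
  obtain ⟨a1, a2, a3⟩ := eqsA K V b c β hQ _ _ _ hB _ _ _ _ _ _ _ _ _ hS
  by_cases hg : g = 0
  · subst hg
    have hf : f = 0 := by linear_combination a1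
    subst hf
    exact caseI K V h2 b c β hQ h (by tauto) hB _ _ _ _ _ _ _ _ _ hS
  have hf : f ≠ 0 := by
    rintro rfl
    apply hg; linear_combination a2
  obtain ⟨b00, b01, b10, b11⟩ := hB
  by_cases hfg : f = -g
  · obtain ⟨b', b0, b1⟩ := newBasis K V b 1 g⁻¹ 0 one_ne_zero (inv_ne_zero hg)
    have hB' : BShape K V b' β 0 (-1) 1 (h * g⁻¹ ^ 2) := by
      refine ⟨?_, ?_, ?_, ?_⟩ <;>
      simp only [b0, b1, tmul_add, add_tmul, tmul_smul, ← smul_tmul', map_add, map_smul,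
          b00, b01, b10, b11, hfg] <;> match_scalars <;> field_simp <;> ring
    obtain ⟨l, p, q, r, s, A, B, C, D, hS'⟩ := shape K V b' c β hQ _ _ _ _ hB' (by simp)
    exact caseIIb K V h2 b' c β hQ _ hB' _ _ _ _ _ _ _ _ _ hS'
  · have hfg' : f + g ≠ 0 := fun h => hfg (by linear_combination h)
    obtain ⟨b', b0, b1⟩ := newBasis K V b 1 g⁻¹ (-(h * g⁻¹ / (f + g))) one_ne_zero (inv_ne_zero hg)
    have hB' : BShape K V b' β 0 (f / g) 1 0 := by
      refine ⟨?_, ?_, ?_, ?_⟩ <;>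
      simp only [b0, b1, tmul_add, add_tmul, tmul_smul, ← smul_tmul', map_add, map_smul,
          b00, b01, b10, b11] <;> match_scalars <;> field_simp <;> ring
    obtain ⟨l, p, q, r, s, A, B, C, D, hS'⟩ := shape K V b' c β hQ _ _ _ _ hB' (by simp)
    refine caseIIa K V b' c β hQ _ (div_ne_zero hf hg) ?_ hB' _ _ _ _ _ _ _ _ _ hS'
    intro h1
    apply hfg
    field_simp at h1
    exact h1

/-- Classification of the two-dimensional lifted QLie algebras with `dim Im β = 1`
(Table 1 of the paper): there is a basis `x₁, x₂` of `V` and `γ ∈ K` so that `c` and `β`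
take one of the eight canonical forms. -/
theorem classification_dim_two_rank_one
    (hchar : ringChar K ≠ 2)
    (c : (V ⊗[K] V) →ₗ[K] (V ⊗[K] V)) (β : (V ⊗[K] V) →ₗ[K] V)
    (hQ : IsLiftedQLie K V c β)
    (hdim : Module.finrank K V = 2)
    (hβ : β ≠ 0)
    (h : Polynomial K)
    (hmin : minpoly K c = (Polynomial.X + 1) * h)
    (hh : Polynomial.eval (-1 : K) h ≠ 0)
    (him : Module.finrank K (LinearMap.range β) = 1) :
    ∃ (b : Module.Basis (Fin 2) K V) (γ : K),
      -- (1) the flip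
      ((∀ i j : Fin 2, c (b i ⊗ₜ[K] b j) = b j ⊗ₜ[K] b i) ∧ BetaStd K V b β) ∨
      -- (2)
      (c (b 0 ⊗ₜ[K] b 0) = b 0 ⊗ₜ[K] b 0 ∧
        c (b 1 ⊗ₜ[K] b 0) = b 0 ⊗ₜ[K] b 0 + b 0 ⊗ₜ[K] b 1 ∧
        c (b 0 ⊗ₜ[K] b 1) = - (b 0 ⊗ₜ[K] b 0) + b 1 ⊗ₜ[K] b 0 ∧
        c (b 1 ⊗ₜ[K] b 1) = b 1 ⊗ₜ[K] b 1 ∧ BetaStd K V b β) ∨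
      -- (3)
      (c (b 0 ⊗ₜ[K] b 0) = - (b 0 ⊗ₜ[K] b 0) ∧
        c (b 1 ⊗ₜ[K] b 0) = b 0 ⊗ₜ[K] b 1 ∧
        c (b 0 ⊗ₜ[K] b 1) = b 1 ⊗ₜ[K] b 0 ∧
        c (b 1 ⊗ₜ[K] b 1) = γ • (b 0 ⊗ₜ[K] b 0) + b 1 ⊗ₜ[K] b 1 ∧
        (γ = 0 ∨ γ = 1 ∨ ¬ ∃ s : K, s ^ 2 = γ) ∧ BetaStd K V b β) ∨
      -- (4)
      (c (b 0 ⊗ₜ[K] b 0) = b 0 ⊗ₜ[K] b 0 ∧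
        c (b 1 ⊗ₜ[K] b 0) = b 0 ⊗ₜ[K] b 1 ∧
        c (b 0 ⊗ₜ[K] b 1) = b 1 ⊗ₜ[K] b 0 ∧
        c (b 1 ⊗ₜ[K] b 1) = γ • (b 0 ⊗ₜ[K] b 0) - b 1 ⊗ₜ[K] b 1 ∧
        (γ = 0 ∨ γ = 1 ∨ ¬ ∃ s : K, s ^ 2 = γ) ∧
        β (b 0 ⊗ₜ[K] b 0) = 0 ∧ β (b 1 ⊗ₜ[K] b 0) = 0 ∧
        β (b 0 ⊗ₜ[K] b 1) = 0 ∧ β (b 1 ⊗ₜ[K] b 1) = b 0) ∨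
      -- (5)
      (c (b 0 ⊗ₜ[K] b 0) = 0 ∧
        c (b 1 ⊗ₜ[K] b 0) = b 0 ⊗ₜ[K] b 0 + b 0 ⊗ₜ[K] b 1 ∧
        c (b 0 ⊗ₜ[K] b 1) = b 1 ⊗ₜ[K] b 0 ∧
        c (b 1 ⊗ₜ[K] b 1) = b 1 ⊗ₜ[K] b 1 ∧ BetaStd K V b β) ∨
      -- (6)
      (c (b 0 ⊗ₜ[K] b 0) = 0 ∧
        c (b 1 ⊗ₜ[K] b 0) = γ⁻¹ • (b 0 ⊗ₜ[K] b 1) ∧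
        c (b 0 ⊗ₜ[K] b 1) = γ • (b 1 ⊗ₜ[K] b 0) ∧
        c (b 1 ⊗ₜ[K] b 1) = b 1 ⊗ₜ[K] b 1 ∧
        γ ≠ 0 ∧ γ ≠ 1 ∧
        β (b 0 ⊗ₜ[K] b 0) = 0 ∧ β (b 1 ⊗ₜ[K] b 0) = b 0 ∧
        β (b 0 ⊗ₜ[K] b 1) = - (γ • b 0) ∧ β (b 1 ⊗ₜ[K] b 1) = 0) ∨
      -- (7)
      (c (b 0 ⊗ₜ[K] b 0) = γ • (b 0 ⊗ₜ[K] b 0) ∧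
        c (b 1 ⊗ₜ[K] b 0) = b 0 ⊗ₜ[K] b 1 ∧
        c (b 0 ⊗ₜ[K] b 1) = b 1 ⊗ₜ[K] b 0 ∧
        c (b 1 ⊗ₜ[K] b 1) = b 1 ⊗ₜ[K] b 1 ∧
        γ ≠ 1 ∧ γ ≠ -1 ∧ BetaStd K V b β) ∨
      -- (8)
      (c (b 0 ⊗ₜ[K] b 0) = b 0 ⊗ₜ[K] b 0 ∧
        c (b 1 ⊗ₜ[K] b 0) = b 0 ⊗ₜ[K] b 1 ∧
        c (b 0 ⊗ₜ[K] b 1) = b 1 ⊗ₜ[K] b 0 ∧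
        c (b 1 ⊗ₜ[K] b 1) = γ • (b 0 ⊗ₜ[K] b 0) + b 1 ⊗ₜ[K] b 1 ∧
        (γ = 1 ∨ ¬ ∃ s : K, s ^ 2 = γ) ∧ BetaStd K V b β) := by
  exact main K V (Ring.two_ne_zero hchar) c β hQ hdim hβ him

end
end
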